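/- arXiv:2007.05321 — 2 statements merged into one kernel-verified Lean document; each statement's English description precedes it below -/
import Mathlib

section
/- Let A be an Artin algebra, C and T self-orthogonal finitely generated A-modules such that (C,T) is a tilting pair (T∈hat(add C), C∈check(add T)). If T is an n-tilting pair (add C-dim add T ≤ n), then for a module M the following are equivalent: (1) M∈_TX; (2) M∈T^⊥∩ _CX; (3) M∈Pres^n_{_CX}(add T). -/
open CategoryTheory CategoryTheory.Limits Opposite

noncomputable section

universe v u

variable (C : Type u) [Category.{v} C] [Abelian C] [EnoughProjectives C] [EnoughInjectives C]

/-- The `i`-th Ext group from `X` to `Y` vanishes. -/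
def extZero (i : ℕ) (X Y : C) : Prop :=
  Limits.IsZero (((Ext ℤ C i).obj (op X)).obj Y)

variable {C}

/-- A class of objects is self-orthogonal if all positive-degree Ext groups
between its members vanish. -/
def SelfOrth (ω : Set C) : Prop :=
  ∀ W ∈ ω, ∀ W' ∈ ω, ∀ i ≥ 1, extZero C i W W'

/-- The right orthogonal class `ω^⊥`. -/
def rightPerp (ω : Set C) : Set C :=
  {Y | ∀ W ∈ ω, ∀ i ≥ 1, extZero C i W Y}

/-- The left orthogonal class `^⊥ω`. -/
def leftPerp (ω : Set C) : Set C :=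
  {Y | ∀ W ∈ ω, ∀ i ≥ 1, extZero C i Y W}

/-- There exists a short exact sequence `0 → X → Y → Z → 0`. -/
def SES (X Y Z : C) : Prop :=
  ∃ (f : X ⟶ Y) (g : Y ⟶ Z) (w : f ≫ g = 0), (ShortComplex.mk f g w).ShortExact

/-- `coresol ω n` is the class of objects admitting an `ω`-coresolution
`0 → X → W⁰ → ⋯ → Wⁿ → 0` of length `n`. -/
def coresol (ω : Set C) : ℕ → Set C
  | 0 => {X | ∃ W ∈ ω, Nonempty (X ≅ W)}
  | n + 1 => {X | ∃ W ∈ ω, ∃ X', SES X W X' ∧ X' ∈ coresol ω n}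

/-- `check(ω)`: objects with a finite `ω`-coresolution. -/
def checkCat (ω : Set C) : Set C := ⋃ n, coresol ω n

/-- `resol ω n` is the class of objects admitting an `ω`-resolution
`0 → Wₙ → ⋯ → W₀ → X → 0` of length `n`. -/
def resol (ω : Set C) : ℕ → Set C
  | 0 => {X | ∃ W ∈ ω, Nonempty (X ≅ W)}
  | n + 1 => {X | ∃ W ∈ ω, ∃ X', SES X' W X ∧ X' ∈ resol ω n}

/-- `hat(ω)`: objects with a finite `ω`-resolution. -/
def hatCat (ω : Set C) : Set C := ⋃ n, resol ω n

/-- `_ωX`: objects admitting an exact proper `ω`-resolution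
`⋯ → W₁ → W₀ → A → 0` with all syzygies in `ω^⊥`. -/
def omX (ω : Set C) : Set C :=
  {A | ∃ K W : ℕ → C, K 0 = A ∧ (∀ i, W i ∈ ω) ∧
    (∀ i, K (i + 1) ∈ rightPerp ω) ∧ ∀ i, SES (K (i + 1)) (W i) (K i)}

/-- `X_ω`: objects admitting an exact coproper `ω`-coresolution
`0 → A → W⁰ → W¹ → ⋯` with all cosyzygies in `^⊥ω`. -/
def Xom (ω : Set C) : Set C :=
  {A | ∃ K W : ℕ → C, K 0 = A ∧ (∀ i, W i ∈ ω) ∧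
    (∀ i, K (i + 1) ∈ leftPerp ω) ∧ ∀ i, SES (K i) (W i) (K (i + 1))}

/-- `Pres^n_D(ω)`: objects `M` with an exact sequence
`0 → X → Tₙ → ⋯ → T₁ → M → 0`, `Tᵢ ∈ ω`, `X ∈ D`. -/
def Pres (D ω : Set C) : ℕ → Set C
  | 0 => D
  | n + 1 => {M | ∃ T ∈ ω, ∃ X, SES X T M ∧ X ∈ Pres D ω n}

/-- `ω`-codimension: the least length of an `ω`-coresolution. -/
def codim (ω : Set C) (M : C) : ℕ := sInf {n | M ∈ coresol ω n}

/-- `I` is a relative injective cogenerator of `Y`. -/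
def RelInjCogen (I Y : Set C) : Prop :=
  I ⊆ Y ∧ (∀ X ∈ I, ∀ Z ∈ Y, ∀ i ≥ 1, extZero C i Z X) ∧
    ∀ Z ∈ Y, ∃ I₀ ∈ I, ∃ Z', Z' ∈ Y ∧ SES Z I₀ Z'

/-- The direct sum of `n + 1` copies of `T`. -/
def nsum (T : C) : ℕ → C
  | 0 => T
  | n + 1 => T ⊞ nsum T n

/-- `add T`: direct summands of finite direct sums of copies of `T`. -/
def addOf (T : C) : Set C :=
  {X | ∃ (n : ℕ) (Y : C), Nonempty ((X ⊞ Y) ≅ nsum T n)}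


section ArtinAlgebra

variable (R : Type) [CommRing R] [IsArtinianRing R]
variable (A : Type) [Ring A] [Algebra R A] [Module.Finite R A]
variable [Abelian (FGModuleCat A)] [EnoughProjectives (FGModuleCat A)]
variable [EnoughInjectives (FGModuleCat A)]

/-- `M` is a self-orthogonal module: `Ext^i(M, M) = 0` for all `i ≥ 1`. -/
def SelfOrthMod (M : FGModuleCat A) : Prop :=
  ∀ i ≥ 1, extZero (FGModuleCat A) i M M

/-- `(C, T)` is a tilting pair in `mod A`. -/
def TiltingPair (Cm Tm : FGModuleCat A) : Prop :=
  SelfOrthMod A Cm ∧ SelfOrthMod A Tm ∧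
    Tm ∈ hatCat (addOf Cm) ∧ Cm ∈ checkCat (addOf Tm)

/-- `(C, T)` is an `n`-tilting pair: a tilting pair with `add C`-resolution
dimension of `add T` at most `n`. -/
def nTiltingPair (Cm Tm : FGModuleCat A) (n : ℕ) : Prop :=
  TiltingPair A Cm Tm ∧ ∀ X ∈ addOf Tm, X ∈ resol (addOf Cm) n

end ArtinAlgebra

section ShortExactSequences

open scoped ZeroObject

variable {𝒜 : Type u} [Category.{v} 𝒜] [Abelian 𝒜]

lemma ses_of_kernel {X Y Z : 𝒜} (f : X ⟶ Y) (g : Y ⟶ Z) (w : f ≫ g = 0) [Mono f] [Epi g]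
    (h : ∀ {A : 𝒜} (k : A ⟶ Y), k ≫ g = 0 → ∃ l : A ⟶ X, l ≫ f = k) : SES X Y Z :=
  ⟨f, g, w, { exact := ShortComplex.exact_of_f_is_kernel _
                (KernelFork.IsLimit.ofι' f w fun k hk => ⟨(h k hk).choose, (h k hk).choose_spec⟩) }⟩

lemma ses_of_cokernel {X Y Z : 𝒜} (f : X ⟶ Y) (g : Y ⟶ Z) (w : f ≫ g = 0) [Mono f] [Epi g]
    (h : ∀ {A : 𝒜} (k : Y ⟶ A), f ≫ k = 0 → ∃ l : Z ⟶ A, g ≫ l = k) : SES X Y Z :=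
  ⟨f, g, w, { exact := ShortComplex.exact_of_g_is_cokernel _
                (CokernelCofork.IsColimit.ofπ' g w fun k hk =>
                  ⟨(h k hk).choose, (h k hk).choose_spec⟩) }⟩

lemma ses_biprod (X Y : 𝒜) : SES X (X ⊞ Y) Y :=
  ⟨biprod.inl, biprod.snd, by simp, (ShortComplex.Splitting.ofHasBinaryBiproduct X Y).shortExact⟩

lemma SES.of_iso_middle {X Y Y' Z : 𝒜} (h : SES X Y Z) (e : Y ≅ Y') : SES X Y' Z := by
  obtain ⟨f, g, w, h⟩ := h
  exact ⟨f ≫ e.hom, e.inv ≫ g, by simp [w], ShortComplex.shortExact_of_iso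
    (S₁ := ShortComplex.mk f g w) (S₂ := ShortComplex.mk (f ≫ e.hom) (e.inv ≫ g) (by simp [w]))
    (ShortComplex.isoMk (Iso.refl _) e (Iso.refl _)) h⟩

lemma ses_biprod' (X Y : 𝒜) : SES Y (X ⊞ Y) X :=
  (ses_biprod Y X).of_iso_middle (biprod.braiding Y X)

lemma ses_of_iso_right {X Y : 𝒜} (e : X ≅ Y) : SES (0 : 𝒜) X Y :=
  ses_of_kernel 0 e.hom (by simp) fun k hk => ⟨0, by
    rw [← cancel_mono e.hom, hk]; simp⟩

lemma ses_of_iso_left {X Y : 𝒜} (e : X ≅ Y) : SES X Y (0 : 𝒜) :=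
  ses_of_cokernel e.hom 0 (by simp) fun k hk => ⟨0, by
    rw [← cancel_epi e.hom, hk]; simp⟩

/-- The kernel of an epimorphism is preserved under base change. -/
lemma ses_of_isPullback {X Y Z V P : 𝒜} {f : X ⟶ Y} {g : Y ⟶ Z} {w : f ≫ g = 0}
    (h : (ShortComplex.mk f g w).ShortExact) {p : V ⟶ Z} {a : P ⟶ Y} {b : P ⟶ V}
    (sq : IsPullback a b g p) : SES X P V := by
  have := h.mono_f
  have := h.epi_g
  dsimp at *
  have : Epi b := Abelian.epi_snd_of_isLimit _ _ sq.isLimit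
  have hf : f ≫ g = (0 : X ⟶ V) ≫ p := by simp [w]
  have : Mono (sq.lift f 0 hf) := mono_of_mono_fac (sq.lift_fst f 0 hf)
  refine ses_of_kernel (sq.lift f 0 hf) b (sq.lift_snd _ _ _) fun k hk => ?_
  have hk' : (k ≫ a) ≫ g = 0 := by rw [Category.assoc, sq.w, reassoc_of% hk, zero_comp]
  refine ⟨h.exact.lift (k ≫ a) hk', sq.hom_ext ?_ ?_⟩
  · rw [Category.assoc, sq.lift_fst]
    exact h.exact.lift_f _ _
  · simp [hk]

/-- The cokernel of a monomorphism is preserved under cobase change. -/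
lemma ses_of_isPushout {X Y Z V P : 𝒜} {f : X ⟶ Y} {g : Y ⟶ Z} {w : f ≫ g = 0}
    (h : (ShortComplex.mk f g w).ShortExact) {p : X ⟶ V} {a : Y ⟶ P} {b : V ⟶ P}
    (sq : IsPushout f p a b) : SES V P Z := by
  have := h.mono_f
  have := h.epi_g
  dsimp at *
  have : Mono b := Abelian.mono_inr_of_isColimit _ _ sq.isColimit
  have hg : f ≫ g = p ≫ (0 : V ⟶ Z) := by simp [w]
  have : Epi (sq.desc g 0 hg) := epi_of_epi_fac (sq.inl_desc g 0 hg)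
  refine ses_of_cokernel b (sq.desc g 0 hg) (sq.inr_desc _ _ _) fun k hk => ?_
  have hk' : f ≫ a ≫ k = 0 := by rw [← Category.assoc, sq.w, Category.assoc, hk, comp_zero]
  refine ⟨h.exact.desc (a ≫ k) hk', sq.hom_ext ?_ ?_⟩
  · rw [sq.inl_desc_assoc]
    exact h.exact.g_desc _ _
  · simp [hk]

lemma SES.pullback {X Y Z X' V : 𝒜} (h : SES X Y Z) (h' : SES X' V Z) :
    ∃ P, SES X P V ∧ SES X' P Y := by
  obtain ⟨f, g, w, h⟩ := h
  obtain ⟨f', g', w', h'⟩ := h'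
  have sq := IsPullback.of_hasPullback g g'
  exact ⟨_, ses_of_isPullback h sq, ses_of_isPullback h' sq.flip⟩

lemma SES.pushout {X Y Z V Z' : 𝒜} (h : SES X Y Z) (h' : SES X V Z') :
    ∃ P, SES V P Z ∧ SES Y P Z' := by
  obtain ⟨f, g, w, h⟩ := h
  obtain ⟨f', g', w', h'⟩ := h'
  have sq := IsPushout.of_hasPushout f f'
  exact ⟨_, ses_of_isPushout h sq, ses_of_isPushout h' sq.flip⟩

/-- The kernel of a composite of two epimorphisms is an extension of their kernels. -/
lemma SES.comp_epi {A B A' B' D : 𝒜} (h : SES A B' B) (h' : SES A' B D) :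
    ∃ K, SES K B' D ∧ SES A K A' := by
  obtain ⟨i, f, w, h⟩ := h
  obtain ⟨j, g, w', h'⟩ := h'
  have := h.epi_g
  have := h'.epi_g
  have := h'.mono_f
  dsimp at *
  have sq := IsPullback.of_hasPullback f j
  refine ⟨_, ses_of_kernel (pullback.fst f j) (f ≫ g) (by simp [reassoc_of% sq.w, w'])
    fun k hk => ?_, ses_of_isPullback h sq⟩
  have hk' : (k ≫ f) ≫ g = 0 := by simpa using hk
  exact ⟨sq.lift k (h'.exact.lift (k ≫ f) hk') (h'.exact.lift_f _ _).symm, sq.lift_fst _ _ _⟩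

/-- The cokernel of a composite of two monomorphisms is an extension of their cokernels. -/
lemma SES.comp_mono {A B B' D D' : 𝒜} (h : SES A B D) (h' : SES B B' D') :
    ∃ Q, SES A B' Q ∧ SES D Q D' := by
  obtain ⟨i, f, w, h⟩ := h
  obtain ⟨j, g, w', h'⟩ := h'
  have := h.mono_f
  have := h'.mono_f
  have := h.epi_g
  dsimp at *
  have sq := IsPushout.of_hasPushout j f
  refine ⟨_, ses_of_cokernel (i ≫ j) (pushout.inl j f) (by simp [sq.w, reassoc_of% w])
    fun k hk => ?_, ses_of_isPushout h' sq⟩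
  have hk' : i ≫ j ≫ k = 0 := by simpa using hk
  exact ⟨sq.desc k (h.exact.desc (j ≫ k) hk') (h.exact.g_desc _ _).symm, sq.inl_desc _ _ _⟩

end ShortExactSequences

section ExtVanishing

variable {𝒜 : Type u} [Category.{v} 𝒜] [Abelian 𝒜] [EnoughProjectives 𝒜] {X Y Z : 𝒜}

/-- The groups `Ext ℤ 𝒜 (i + 1)` and `Abelian.Ext` vanish simultaneously. -/
lemma extZero_succ_iff [HasExt.{v} 𝒜] (i : ℕ) (X Y : 𝒜) :
    extZero 𝒜 (i + 1) X Y ↔ ∀ e : Abelian.Ext.{v} X Y (i + 1), e = 0 := by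
  let P := projectiveResolution X
  have key : extZero 𝒜 (i + 1) X Y ↔ ∀ f : P.complex.X (i + 1) ⟶ Y,
      P.complex.d (i + 2) (i + 1) ≫ f = 0 → ∃ g, P.complex.d (i + 1) i ≫ g = f := by
    unfold extZero
    rw [(P.isoExt (R := ℤ) (i + 1) Y).isZero_iff, ← HomologicalComplex.exactAt_iff_isZero_homology,
      HomologicalComplex.exactAt_iff' _ i (i + 1) (i + 2) (by simp) (by simp),
      ShortComplex.moduleCat_exact_iff]
    rfl
  rw [key]
  constructor
  · intro h e
    obtain ⟨f, hf, rfl⟩ := P.extMk_surjective e (i + 2) rfl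
    exact (P.extMk_eq_zero_iff f _ rfl hf i rfl).2 (h f hf)
  · intro h f hf
    exact (P.extMk_eq_zero_iff f _ rfl hf i rfl).1 (h _)

/-- `Ext^i(X, Y) = 0` for all `i > d`. -/
def ExtVanishAbove (d : ℕ) (X Y : 𝒜) : Prop := ∀ i, d ≤ i → extZero 𝒜 (i + 1) X Y

lemma extVanishAbove_iff [HasExt.{v} 𝒜] {d : ℕ} :
    ExtVanishAbove d X Y ↔ ∀ i, d ≤ i → ∀ e : Abelian.Ext.{v} X Y (i + 1), e = 0 := by
  simp only [ExtVanishAbove, extZero_succ_iff]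

lemma extVanishAbove_zero_iff : ExtVanishAbove 0 X Y ↔ ∀ i ≥ 1, extZero 𝒜 i X Y := by
  refine ⟨fun h i hi => ?_, fun h i _ => h (i + 1) (by omega)⟩
  obtain ⟨j, rfl⟩ := Nat.exists_eq_add_of_le' hi
  exact h j (by omega)

namespace ExtVanishAbove

variable {d e : ℕ} {W A B D : 𝒜}

lemma mono (h : ExtVanishAbove d X Y) (hde : d ≤ e) : ExtVanishAbove e X Y :=
  fun i hi => h i (hde.trans hi)

lemma middle (hs : SES A B D) (hA : ExtVanishAbove d W A) (hD : ExtVanishAbove d W D) :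
    ExtVanishAbove d W B := by
  have := hasExt_of_enoughProjectives.{v} 𝒜
  obtain ⟨f, g, w, hs⟩ := hs
  rw [extVanishAbove_iff] at *
  intro i hi x
  obtain ⟨y, rfl⟩ := Abelian.Ext.covariant_sequence_exact₂ W hs x (hD i hi _)
  simp [hA i hi y]

lemma right (hs : SES A B D) (hB : ExtVanishAbove d W B) (hA : ExtVanishAbove (d + 1) W A) :
    ExtVanishAbove d W D := by
  have := hasExt_of_enoughProjectives.{v} 𝒜
  obtain ⟨f, g, w, hs⟩ := hs
  rw [extVanishAbove_iff] at *
  intro i hi x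
  obtain ⟨y, rfl⟩ := Abelian.Ext.covariant_sequence_exact₃ W hs x rfl (hA (i + 1) (by omega) _)
  simp [hB i hi y]

lemma middle' (hs : SES A B D) (hA : ExtVanishAbove d A W) (hD : ExtVanishAbove d D W) :
    ExtVanishAbove d B W := by
  have := hasExt_of_enoughProjectives.{v} 𝒜
  obtain ⟨f, g, w, hs⟩ := hs
  rw [extVanishAbove_iff] at *
  intro i hi x
  obtain ⟨y, rfl⟩ := Abelian.Ext.contravariant_sequence_exact₂ hs W x (hA i hi _)
  simp [hD i hi y]

lemma left' (hs : SES A B D) (hB : ExtVanishAbove d B W) (hD : ExtVanishAbove (d + 1) D W) :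
    ExtVanishAbove d A W := by
  have := hasExt_of_enoughProjectives.{v} 𝒜
  obtain ⟨f, g, w, hs⟩ := hs
  rw [extVanishAbove_iff] at *
  intro i hi x
  obtain ⟨y, rfl⟩ := Abelian.Ext.contravariant_sequence_exact₁ hs W x
    (n₁ := i + 1 + 1) (by omega) (hD (i + 1) (by omega) _)
  simp [hB i hi y]

lemma right' (hs : SES A B D) (hA : ExtVanishAbove d A W) (hB : ExtVanishAbove (d + 1) B W) :
    ExtVanishAbove (d + 1) D W := by
  have := hasExt_of_enoughProjectives.{v} 𝒜
  obtain ⟨f, g, w, hs⟩ := hs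
  rw [extVanishAbove_iff] at *
  intro i hi x
  obtain ⟨j, rfl⟩ := Nat.exists_eq_add_of_le' (show 1 ≤ i by omega)
  obtain ⟨y, rfl⟩ := Abelian.Ext.contravariant_sequence_exact₃ hs W x
    (hB (j + 1) hi _) (n₀ := j + 1) (by omega)
  simp [hA j (by omega) y]

lemma of_retract (r : Retract X Y) (h : ExtVanishAbove d W Y) : ExtVanishAbove d W X := by
  have := hasExt_of_enoughProjectives.{v} 𝒜
  rw [extVanishAbove_iff] at *
  intro i hi x
  have := congrArg (fun y => y.comp (Abelian.Ext.mk₀ r.r) (add_zero (i + 1)))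
    (h i hi (x.comp (Abelian.Ext.mk₀ r.i) (add_zero (i + 1))))
  simpa using this

lemma of_retract' (r : Retract X Y) (h : ExtVanishAbove d Y W) : ExtVanishAbove d X W := by
  have := hasExt_of_enoughProjectives.{v} 𝒜
  rw [extVanishAbove_iff] at *
  intro i hi x
  have := congrArg (fun y => (Abelian.Ext.mk₀ r.i).comp y (zero_add (i + 1)))
    (h i hi ((Abelian.Ext.mk₀ r.r).comp x (zero_add (i + 1))))
  simpa using this

end ExtVanishAbove

/-- An extension of `Z` by `X` splits if `Ext^1(Z, X) = 0`. -/
lemma SES.nonempty_iso_biprod (hs : SES X Y Z) (h : ExtVanishAbove 0 Z X) :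
    Nonempty (Y ≅ X ⊞ Z) := by
  have := hasExt_of_enoughProjectives.{v} 𝒜
  obtain ⟨f, g, w, hs⟩ := hs
  rw [extVanishAbove_iff] at h
  obtain ⟨y, hy⟩ := Abelian.Ext.contravariant_sequence_exact₁ hs X
    (Abelian.Ext.mk₀ (𝟙 X)) (add_zero 1) (h 0 le_rfl _)
  obtain ⟨r, rfl⟩ := (Abelian.Ext.mk₀_bijective _ _).2 y
  have hr : f ≫ r = 𝟙 X := (Abelian.Ext.mk₀_bijective _ _).1 (by simpa using hy)
  exact ⟨(ShortComplex.Splitting.ofExactOfRetraction _ hs.exact r hr hs.epi_g).isoBinaryBiproduct⟩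

end ExtVanishing

section RelativeResolutions

open scoped ZeroObject

variable {𝒜 : Type u} [Category.{v} 𝒜] [Abelian 𝒜]

lemma SES.biprod_map_id {X' W X : 𝒜} (h : SES X' W X) (V : 𝒜) : SES X' (W ⊞ V) (X ⊞ V) := by
  obtain ⟨f, g, w, h⟩ := h
  have := h.mono_f
  have := h.epi_g
  dsimp at *
  refine ses_of_kernel (f ≫ biprod.inl) (biprod.map g (𝟙 V)) (by simp [reassoc_of% w])
    fun k hk => ?_
  have h₁ : (k ≫ biprod.fst) ≫ g = 0 := by simpa using hk =≫ biprod.fst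
  have h₂ : k ≫ biprod.snd = 0 := by simpa using hk =≫ biprod.snd
  refine ⟨h.exact.lift _ h₁, biprod.hom_ext _ _ ?_ ?_⟩
  · simpa using h.exact.lift_f _ h₁
  · simp [h₂]

lemma SES.biprod_id_map {X W X' : 𝒜} (h : SES X W X') (V : 𝒜) : SES (V ⊞ X) (V ⊞ W) X' := by
  obtain ⟨f, g, w, h⟩ := h
  have := h.mono_f
  have := h.epi_g
  dsimp at *
  refine ses_of_cokernel (biprod.map (𝟙 V) f) (biprod.snd ≫ g) (by simp [w]) fun k hk => ?_
  have h₁ : f ≫ biprod.inr ≫ k = 0 := by simpa using biprod.inr ≫= hk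
  have h₂ : biprod.inl ≫ k = 0 := by simpa using biprod.inl ≫= hk
  refine ⟨h.exact.desc _ h₁, biprod.hom_ext' _ _ ?_ ?_⟩
  · simp [h₂]
  · simpa using h.exact.g_desc _ h₁

/-- Interchange of the two middle summands of a fourfold biproduct. -/
def biprodInterchange (X Y X' Y' : 𝒜) : (X ⊞ X') ⊞ (Y ⊞ Y') ≅ (X ⊞ Y) ⊞ (X' ⊞ Y') where
  hom := biprod.lift (biprod.map biprod.fst biprod.fst) (biprod.map biprod.snd biprod.snd)
  inv := biprod.lift (biprod.map biprod.fst biprod.fst) (biprod.map biprod.snd biprod.snd)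

lemma nonempty_nsum_biprod_iso (T : 𝒜) (n m : ℕ) :
    Nonempty (nsum T n ⊞ nsum T m ≅ nsum T (n + m + 1)) := by
  induction n with
  | zero => exact ⟨eqToIso (by rw [Nat.zero_add]; rfl)⟩
  | succ n ih =>
    obtain ⟨e⟩ := ih
    exact ⟨biprod.associator _ _ _ ≪≫ biprod.mapIso (Iso.refl T) e ≪≫
      eqToIso (by rw [Nat.add_right_comm n 1 m]; rfl)⟩

lemma mem_addOf_self (T : 𝒜) : T ∈ addOf T := ⟨0, 0, ⟨isoBiprodZero (isZero_zero _) |>.symm⟩⟩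

lemma zero_mem_addOf (T : 𝒜) : (0 : 𝒜) ∈ addOf T :=
  ⟨0, T, ⟨isoZeroBiprod (isZero_zero _) |>.symm⟩⟩

lemma biprod_mem_addOf {T X Y : 𝒜} (hX : X ∈ addOf T) (hY : Y ∈ addOf T) :
    (X ⊞ Y) ∈ addOf T := by
  obtain ⟨n, X', ⟨e⟩⟩ := hX
  obtain ⟨m, Y', ⟨e'⟩⟩ := hY
  obtain ⟨i⟩ := nonempty_nsum_biprod_iso T n m
  exact ⟨_, _, ⟨biprodInterchange X X' Y Y' ≪≫ biprod.mapIso e e' ≪≫ i⟩⟩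

lemma addOf_of_iso {T X Y : 𝒜} (e : X ≅ Y) (hY : Y ∈ addOf T) : X ∈ addOf T := by
  obtain ⟨n, Y', ⟨i⟩⟩ := hY
  exact ⟨n, Y', ⟨biprod.mapIso e (Iso.refl _) ≪≫ i⟩⟩

variable {T X Y Z : 𝒜}

lemma coresol_succ {m : ℕ} (hX : X ∈ coresol (addOf T) m) : X ∈ coresol (addOf T) (m + 1) := by
  induction m generalizing X with
  | zero =>
    obtain ⟨W, hW, ⟨e⟩⟩ := hX
    exact ⟨W, hW, 0, ses_of_iso_left e, 0, zero_mem_addOf T, ⟨Iso.refl _⟩⟩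
  | succ m ih =>
    obtain ⟨W, hW, X', hs, hX'⟩ := hX
    exact ⟨W, hW, X', hs, ih hX'⟩

lemma coresol_mono {m n : ℕ} (hmn : m ≤ n) (hX : X ∈ coresol (addOf T) m) :
    X ∈ coresol (addOf T) n :=
  Nat.le_induction hX (fun _ _ => coresol_succ) n hmn

lemma exists_ses_of_mem_checkCat (hX : X ∈ checkCat (addOf T)) :
    ∃ W ∈ addOf T, ∃ X' ∈ checkCat (addOf T), SES X W X' := by
  obtain ⟨m, hm⟩ := Set.mem_iUnion.1 hX
  obtain ⟨W, hW, X', hs, hX'⟩ := coresol_succ hm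
  exact ⟨W, hW, X', Set.mem_iUnion.2 ⟨m, hX'⟩, hs⟩

lemma zero_mem_checkCat : (0 : 𝒜) ∈ checkCat (addOf T) :=
  Set.mem_iUnion.2 ⟨0, 0, zero_mem_addOf T, ⟨Iso.refl _⟩⟩

variable [EnoughProjectives 𝒜]

namespace ExtVanishAbove

variable {d : ℕ}

lemma nsum_left (h : ExtVanishAbove d T Y) (n : ℕ) : ExtVanishAbove d (nsum T n) Y := by
  induction n with
  | zero => exact h
  | succ n ih => exact middle' (ses_biprod _ _) h ih

lemma nsum_right (h : ExtVanishAbove d X T) (n : ℕ) : ExtVanishAbove d X (nsum T n) := by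
  induction n with
  | zero => exact h
  | succ n ih => exact middle (ses_biprod _ _) h ih

lemma addOf_left (h : ExtVanishAbove d T Y) (hX : X ∈ addOf T) : ExtVanishAbove d X Y := by
  obtain ⟨n, X', ⟨e⟩⟩ := hX
  exact of_retract' ⟨biprod.inl, biprod.fst, by simp⟩ (of_retract' (Retract.ofIso e) (h.nsum_left n))

lemma addOf_right (h : ExtVanishAbove d X T) (hY : Y ∈ addOf T) : ExtVanishAbove d X Y := by
  obtain ⟨n, X', ⟨e⟩⟩ := hY
  exact of_retract ⟨biprod.inl, biprod.fst, by simp⟩ (of_retract (Retract.ofIso e) (h.nsum_right n))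

lemma coresol_left (h : ExtVanishAbove 0 T Y) {m : ℕ} (hX : X ∈ coresol (addOf T) m) :
    ExtVanishAbove 0 X Y := by
  induction m generalizing X with
  | zero =>
    obtain ⟨W, hW, ⟨e⟩⟩ := hX
    exact of_retract' (Retract.ofIso e) (h.addOf_left hW)
  | succ m ih =>
    obtain ⟨W, hW, X', hs, hX'⟩ := hX
    exact left' hs (h.addOf_left hW) ((ih hX').mono (Nat.zero_le _))

lemma checkCat_left (h : ExtVanishAbove 0 T Y) (hX : X ∈ checkCat (addOf T)) :
    ExtVanishAbove 0 X Y := by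
  obtain ⟨m, hm⟩ := Set.mem_iUnion.1 hX
  exact h.coresol_left hm

lemma resol_left (h : ExtVanishAbove 0 T Y) {m : ℕ} (hX : X ∈ resol (addOf T) m) :
    ExtVanishAbove m X Y := by
  induction m generalizing X with
  | zero =>
    obtain ⟨W, hW, ⟨e⟩⟩ := hX
    exact of_retract' (Retract.ofIso e) (h.addOf_left hW)
  | succ m ih =>
    obtain ⟨W, hW, X', hs, hX'⟩ := hX
    exact right' hs (ih hX') ((h.addOf_left hW).mono (Nat.zero_le _))

end ExtVanishAbove

lemma mem_rightPerp_addOf : Y ∈ rightPerp (addOf T) ↔ ExtVanishAbove 0 T Y :=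
  ⟨fun h => extVanishAbove_zero_iff.2 (h T (mem_addOf_self T)),
    fun h _ hW => extVanishAbove_zero_iff.1 (h.addOf_left hW)⟩

lemma coresol_of_ses (hT : ExtVanishAbove 0 T T) {m : ℕ} (hs : SES X Y Z)
    (hX : X ∈ coresol (addOf T) m) (hZ : Z ∈ coresol (addOf T) m) : Y ∈ coresol (addOf T) m := by
  induction m generalizing X Y Z with
  | zero =>
    obtain ⟨e⟩ := hs.nonempty_iso_biprod <| by
      obtain ⟨W, hW, ⟨i⟩⟩ := hX
      exact ((hT.addOf_right hW).of_retract (Retract.ofIso i)).coresol_left hZ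
    obtain ⟨W, hW, ⟨i⟩⟩ := hX
    obtain ⟨V, hV, ⟨j⟩⟩ := hZ
    exact ⟨W ⊞ V, biprod_mem_addOf hW hV, ⟨e ≪≫ biprod.mapIso i j⟩⟩
  | succ m ih =>
    obtain ⟨W, hW, X', hX, hX'⟩ := hX
    obtain ⟨P, hP, hP'⟩ := hs.pushout hX
    obtain ⟨e⟩ := hP.nonempty_iso_biprod ((hT.addOf_right hW).coresol_left hZ)
    obtain ⟨V, hV, Z', hZ, hZ'⟩ := hZ
    obtain ⟨Y', hY, hY'⟩ := (hP'.of_iso_middle e).comp_mono (hZ.biprod_id_map W)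
    exact ⟨W ⊞ V, biprod_mem_addOf hW hV, Y', hY, ih hY' hX' hZ'⟩

lemma checkCat_of_ses (hT : ExtVanishAbove 0 T T) (hs : SES X Y Z)
    (hX : X ∈ checkCat (addOf T)) (hZ : Z ∈ checkCat (addOf T)) : Y ∈ checkCat (addOf T) := by
  obtain ⟨m, hm⟩ := Set.mem_iUnion.1 hX
  obtain ⟨n, hn⟩ := Set.mem_iUnion.1 hZ
  exact Set.mem_iUnion.2 ⟨max m n, coresol_of_ses hT hs (coresol_mono (le_max_left _ _) hm)
    (coresol_mono (le_max_right _ _) hn)⟩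

lemma nsum_mem_checkCat {U : 𝒜} (hT : ExtVanishAbove 0 T T) (hU : U ∈ checkCat (addOf T)) (k : ℕ) :
    nsum U k ∈ checkCat (addOf T) := by
  induction k with
  | zero => exact hU
  | succ k ih => exact checkCat_of_ses hT (ses_biprod _ _) hU ih

/-- The horseshoe lemma. -/
lemma SES.horseshoe {X' W Z' V : 𝒜} (hs : SES X Y Z) (hX : SES X' W X) (hZ : SES Z' V Z)
    (hV : ExtVanishAbove 0 V X) : ∃ Y', SES Y' (W ⊞ V) Y ∧ SES X' Y' Z' := by
  obtain ⟨P, hP, hP'⟩ := hs.pullback hZ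
  obtain ⟨e⟩ := hP.nonempty_iso_biprod hV
  exact (hX.biprod_map_id V).comp_epi (hP'.of_iso_middle e)

lemma omX_of_forall_exists {ω : Set 𝒜} (E : 𝒜 → Prop)
    (hE : ∀ L, E L → ∃ W ∈ ω, ∃ L', SES L' W L ∧ L' ∈ rightPerp ω ∧ E L') {M : 𝒜} (hM : E M) :
    M ∈ omX ω := by
  choose W hW K hs hK hEK using hE
  let s : ℕ → {L : 𝒜 // E L} := Nat.rec ⟨M, hM⟩ fun _ L => ⟨K L.1 L.2, hEK L.1 L.2⟩
  exact ⟨fun i => (s i).1, fun i => W (s i).1 (s i).2, rfl, fun i => hW _ _, fun i => hK _ _,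
    fun i => hs _ _⟩

lemma exists_ses_of_mem_omX {ω : Set 𝒜} {M : 𝒜} (hM : M ∈ omX ω) :
    ∃ W ∈ ω, ∃ K, SES K W M ∧ K ∈ rightPerp ω ∧ K ∈ omX ω := by
  obtain ⟨K, W, rfl, hW, hK, hs⟩ := hM
  exact ⟨W 0, hW 0, K 1, hs 0, hK 0, fun i => K (i + 1), fun i => W (i + 1), rfl,
    fun i => hW _, fun i => hK _, fun i => hs _⟩

lemma extVanishAbove_of_mem_omX (hT : ExtVanishAbove 0 T T) (hX : X ∈ omX (addOf T)) :
    ExtVanishAbove 0 T X := by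
  obtain ⟨W, hW, K, hs, hK, -⟩ := exists_ses_of_mem_omX hX
  exact .right hs (hT.addOf_right hW) ((mem_rightPerp_addOf.1 hK).mono (Nat.zero_le _))

lemma omX_of_ses_left (hT : ExtVanishAbove 0 T T) (hs : SES X Y Z) (hX : X ∈ omX (addOf T))
    (hY : Y ∈ addOf T) : Z ∈ omX (addOf T) := by
  refine omX_of_forall_exists (fun L => L = Z ∨ L ∈ omX (addOf T)) ?_ (Or.inl rfl)
  rintro L (rfl | hL)
  · exact ⟨Y, hY, X, hs, mem_rightPerp_addOf.2 (extVanishAbove_of_mem_omX hT hX), Or.inr hX⟩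
  · obtain ⟨W, hW, K, hs, hK, hK'⟩ := exists_ses_of_mem_omX hL
    exact ⟨W, hW, K, hs, hK, Or.inr hK'⟩

lemma zero_mem_omX (hT : ExtVanishAbove 0 T T) : (0 : 𝒜) ∈ omX (addOf T) :=
  omX_of_forall_exists (fun L => L = 0) (by
    rintro _ rfl
    exact ⟨0, zero_mem_addOf T, 0, ses_of_iso_right (Iso.refl _),
      mem_rightPerp_addOf.2 (hT.addOf_right (zero_mem_addOf T)), rfl⟩) rfl

lemma resol_subset_omX (hT : ExtVanishAbove 0 T T) {m : ℕ} (hX : X ∈ resol (addOf T) m) :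
    X ∈ omX (addOf T) := by
  induction m generalizing X with
  | zero =>
    obtain ⟨W, hW, ⟨e⟩⟩ := hX
    exact omX_of_ses_left hT (ses_of_iso_right e.symm) (zero_mem_omX hT) hW
  | succ m ih =>
    obtain ⟨W, hW, X', hs, hX'⟩ := hX
    exact omX_of_ses_left hT hs (ih hX') hW

lemma addOf_subset_omX (hT : ExtVanishAbove 0 T T) (hX : X ∈ addOf T) : X ∈ omX (addOf T) :=
  resol_subset_omX hT (m := 0) ⟨X, hX, ⟨Iso.refl _⟩⟩

lemma omX_of_ses_middle (hT : ExtVanishAbove 0 T T) (hs : SES X Y Z) (hX : X ∈ omX (addOf T))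
    (hZ : Z ∈ omX (addOf T)) : Y ∈ omX (addOf T) := by
  refine omX_of_forall_exists
    (fun L => ∃ A ∈ omX (addOf T), ∃ B ∈ omX (addOf T), SES A L B) ?_ ⟨X, hX, Z, hZ, hs⟩
  rintro L ⟨A, hA, B, hB, hL⟩
  have hTA := extVanishAbove_of_mem_omX hT hA
  obtain ⟨W, hW, A', hsA, hA', hA''⟩ := exists_ses_of_mem_omX hA
  obtain ⟨V, hV, B', hsB, hB', hB''⟩ := exists_ses_of_mem_omX hB
  obtain ⟨L', hL', hs'⟩ := hL.horseshoe hsA hsB (hTA.addOf_left hV)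
  rw [mem_rightPerp_addOf] at hA' hB'
  exact ⟨_, biprod_mem_addOf hW hV, L', hL', mem_rightPerp_addOf.2 (.middle hs' hA' hB'),
    A', hA'', B', hB'', hs'⟩

lemma omX_of_ses_right (hT : ExtVanishAbove 0 T T) (hs : SES X Y Z) (hX : X ∈ omX (addOf T))
    (hY : Y ∈ omX (addOf T)) : Z ∈ omX (addOf T) := by
  obtain ⟨W, hW, Y', hsY, -, hY'⟩ := exists_ses_of_mem_omX hY
  obtain ⟨K, hK, hK'⟩ := hsY.comp_epi hs
  exact omX_of_ses_left hT hK (omX_of_ses_middle hT hK' hY' hX) hW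

end RelativeResolutions

section TiltingPairs

open scoped ZeroObject

variable {𝒜 : Type u} [Category.{v} 𝒜] [Abelian 𝒜]

lemma mem_Pres_of_mem_omX [EnoughProjectives 𝒜] {T M : 𝒜} {D : Set 𝒜} (hD : omX (addOf T) ⊆ D)
    (n : ℕ) (hM : M ∈ omX (addOf T)) : M ∈ Pres D (addOf T) n := by
  induction n generalizing M with
  | zero => exact hD hM
  | succ n ih =>
    obtain ⟨W, hW, K, hs, -, hK⟩ := exists_ses_of_mem_omX hM
    exact ⟨W, hW, K, hs, ih hK⟩

/-- The hypotheses on a pair of objects defining an `n`-tilting pair, in an abelian category. -/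
structure IsTiltingPairOfDim [EnoughProjectives 𝒜] (U T : 𝒜) (n : ℕ) : Prop where
  selfOrth_left : ExtVanishAbove 0 U U
  selfOrth_right : ExtVanishAbove 0 T T
  mem_resol : ∀ X ∈ addOf T, X ∈ resol (addOf U) n
  mem_checkCat : U ∈ checkCat (addOf T)

namespace IsTiltingPairOfDim

variable [EnoughProjectives 𝒜] {U T M : 𝒜} {n : ℕ}

lemma addOf_right_subset_omX (h : IsTiltingPairOfDim U T n) {X : 𝒜} (hX : X ∈ addOf T) : X ∈ omX (addOf U) :=
  resol_subset_omX h.selfOrth_left (h.mem_resol X hX)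

lemma omX_subset (h : IsTiltingPairOfDim U T n) : omX (addOf T) ⊆ omX (addOf U) := by
  intro M hM
  have hU := h.selfOrth_left
  have hT := h.selfOrth_right
  refine omX_of_forall_exists
    (fun L => ∃ X ∈ omX (addOf U), ∃ K ∈ omX (addOf T), SES X L K) ?_
    ⟨0, zero_mem_omX hU, M, hM, ses_of_iso_right (Iso.refl M)⟩
  rintro L ⟨X, hX, K, hK, hL⟩
  obtain ⟨W, hW, X', hsX, -, hX'⟩ := exists_ses_of_mem_omX hX
  obtain ⟨T₀, hT₀, K', hsK, -, hK'⟩ := exists_ses_of_mem_omX hK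
  obtain ⟨V, hV, T', hsT, -, hT'⟩ := exists_ses_of_mem_omX (h.addOf_right_subset_omX hT₀)
  obtain ⟨Z, hZ, hZ'⟩ := hsT.comp_epi hsK
  obtain ⟨L', hL', hL''⟩ := hL.horseshoe hsX hZ ((extVanishAbove_of_mem_omX hU hX).addOf_left hV)
  obtain ⟨X'', hs, hs'⟩ := hL''.comp_epi hZ'
  have hX'' := omX_of_ses_middle hU hs' hX' hT'
  exact ⟨_, biprod_mem_addOf hW hV, L', hL', mem_rightPerp_addOf.2
    (.middle hs (extVanishAbove_of_mem_omX hU hX'')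
      ((extVanishAbove_of_mem_omX hT hK').checkCat_left h.mem_checkCat)),
    X'', hX'', K', hK', hs⟩

/-- A member of `_UX` is a quotient of an object with a finite `add T`-coresolution, with kernel
in `_UX`. -/
lemma exists_ses_checkCat (h : IsTiltingPairOfDim U T n) (hM : M ∈ omX (addOf U)) :
    ∃ K ∈ omX (addOf U), ∃ W ∈ omX (addOf U), W ∈ checkCat (addOf T) ∧ SES K W M := by
  obtain ⟨V, hV, K, hs, -, hK⟩ := exists_ses_of_mem_omX hM
  obtain ⟨k, V', ⟨e⟩⟩ := id hV
  obtain ⟨L, hL, hL'⟩ := (ses_biprod' V V').comp_epi hs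
  have hU := h.selfOrth_left
  have hV' : V' ∈ addOf U := ⟨k, V, ⟨biprod.braiding _ _ ≪≫ e⟩⟩
  exact ⟨L, omX_of_ses_middle hU hL' (addOf_subset_omX hU hV') hK, nsum U k,
    addOf_subset_omX hU (addOf_of_iso e.symm (biprod_mem_addOf hV hV')),
    nsum_mem_checkCat h.selfOrth_right h.mem_checkCat k, hL.of_iso_middle e⟩

/-- Given `0 → K → W → M → 0`, an embedding of `K` into `Q` whose cokernel has a finite
`add T`-coresolution induces such an embedding of `M` into an `add T`-cosyzygy of `Q`. -/
lemma exists_coapprox_step (h : IsTiltingPairOfDim U T n) {K W Q D : 𝒜} (hs : SES K W M) (hW : W ∈ omX (addOf U))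
    (hW' : W ∈ checkCat (addOf T)) (hQ : SES K Q D) (hD : D ∈ omX (addOf U))
    (hD' : D ∈ checkCat (addOf T)) :
    ∃ T₀ ∈ addOf T, ∃ Q', ∃ D' ∈ omX (addOf U), D' ∈ checkCat (addOf T) ∧
      SES Q T₀ Q' ∧ SES M Q' D' := by
  have hU := h.selfOrth_left
  obtain ⟨E, hE, hE'⟩ := hQ.pushout hs
  obtain ⟨E, hE, hE'⟩ : ∃ E, SES Q E M ∧ SES W E D := ⟨_, hE', hE⟩
  have hEU := omX_of_ses_middle hU hE' hW hD
  obtain ⟨T₀, hT₀, D', hD', hED⟩ :=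
    exists_ses_of_mem_checkCat (checkCat_of_ses h.selfOrth_right hE' hW' hD')
  obtain ⟨Q', hQ', hQ''⟩ := hE.comp_mono hED
  exact ⟨T₀, hT₀, Q', D', omX_of_ses_right hU hED hEU (h.addOf_right_subset_omX hT₀), hD', hQ', hQ''⟩

lemma exists_coapprox (h : IsTiltingPairOfDim U T n) {d : ℕ} (hd : d ≤ n) (hM : M ∈ omX (addOf U)) :
    ∃ Q, ∃ D ∈ omX (addOf U), D ∈ checkCat (addOf T) ∧ SES M Q D ∧ ExtVanishAbove d T Q := by
  induction hd using Nat.decreasingInduction generalizing M with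
  | self =>
    exact ⟨M, 0, zero_mem_omX h.selfOrth_left, zero_mem_checkCat, ses_of_iso_left (Iso.refl M),
      (extVanishAbove_of_mem_omX h.selfOrth_left hM).resol_left
        (h.mem_resol T (mem_addOf_self T))⟩
  | of_succ d _ ih =>
    obtain ⟨K, hK, W, hW, hW', hs⟩ := h.exists_ses_checkCat hM
    obtain ⟨Q, D, hD, hD', hQ, hQT⟩ := ih hK
    obtain ⟨T₀, hT₀, Q', D', hD, hD', hsQ, hsM⟩ := h.exists_coapprox_step hs hW hW' hQ hD hD'
    exact ⟨Q', D', hD, hD', hsM,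
      .right hsQ ((h.selfOrth_right.addOf_right hT₀).mono (Nat.zero_le _)) hQT⟩

lemma mem_omX_of_extVanishAbove (h : IsTiltingPairOfDim U T n) (hT : ExtVanishAbove 0 T M) (hM : M ∈ omX (addOf U)) :
    M ∈ omX (addOf T) := by
  refine omX_of_forall_exists (fun M => ExtVanishAbove 0 T M ∧ M ∈ omX (addOf U)) ?_ ⟨hT, hM⟩
  rintro M ⟨hT, hM⟩
  have hU := h.selfOrth_left
  obtain ⟨K, hK, W, hW, hW', hs⟩ := h.exists_ses_checkCat hM
  obtain ⟨Q, D, hD, hD', hQ, hQT⟩ := h.exists_coapprox (Nat.zero_le n) hK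
  obtain ⟨T₀, hT₀, Q', D', hDU, hDT, hsQ, hsM⟩ := h.exists_coapprox_step hs hW hW' hQ hD hD'
  have hQ'T : ExtVanishAbove 0 T Q' :=
    .right hsQ (h.selfOrth_right.addOf_right hT₀) (hQT.mono (Nat.zero_le _))
  have hD'T : ExtVanishAbove 0 T D' := .right hsM hQ'T (hT.mono (Nat.zero_le _))
  obtain ⟨e⟩ := hsM.nonempty_iso_biprod (hT.checkCat_left hDT)
  obtain ⟨L, hL, hL'⟩ := hsQ.comp_epi ((ses_biprod' M D').of_iso_middle e.symm)
  have hLT : ExtVanishAbove 0 T L := .middle hL' hQT hD'T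
  exact ⟨T₀, hT₀, L, hL, mem_rightPerp_addOf.2 hLT, hLT,
    omX_of_ses_middle hU hL' (omX_of_ses_middle hU hQ hK hD) hDU⟩

lemma of_mem_Pres (h : IsTiltingPairOfDim U T n) {k d : ℕ} (hkd : d + k = n) (hM : M ∈ Pres (omX (addOf U)) (addOf T) k) :
    ExtVanishAbove d T M ∧ M ∈ omX (addOf U) := by
  induction k generalizing M d with
  | zero =>
    obtain rfl : d = n := hkd
    exact ⟨(extVanishAbove_of_mem_omX h.selfOrth_left hM).resol_left
      (h.mem_resol T (mem_addOf_self T)), hM⟩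
  | succ k ih =>
    obtain ⟨W, hW, X, hs, hX⟩ := hM
    obtain ⟨hXT, hXU⟩ := ih (d := d + 1) (by omega) hX
    exact ⟨.right hs ((h.selfOrth_right.addOf_right hW).mono (Nat.zero_le _)) hXT,
      omX_of_ses_right h.selfOrth_left hs hXU (h.addOf_right_subset_omX hW)⟩

lemma mem_omX_iff (h : IsTiltingPairOfDim U T n) : M ∈ omX (addOf T) ↔ ExtVanishAbove 0 T M ∧ M ∈ omX (addOf U) :=
  ⟨fun hM => ⟨extVanishAbove_of_mem_omX h.selfOrth_right hM, h.omX_subset hM⟩,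
    fun hM => h.mem_omX_of_extVanishAbove hM.1 hM.2⟩

lemma mem_omX_iff_mem_Pres (h : IsTiltingPairOfDim U T n) :
    M ∈ omX (addOf T) ↔ M ∈ Pres (omX (addOf U)) (addOf T) n :=
  ⟨mem_Pres_of_mem_omX h.omX_subset n,
    fun hM => h.mem_omX_iff.2 (h.of_mem_Pres (Nat.zero_add n) hM)⟩

end IsTiltingPairOfDim

end TiltingPairs

section ArtinAlgebra

variable {R : Type} [CommRing R] [IsArtinianRing R]
variable {A : Type} [Ring A] [Algebra R A] [Module.Finite R A]
variable [Abelian (FGModuleCat A)] [EnoughProjectives (FGModuleCat A)]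
variable [EnoughInjectives (FGModuleCat A)]

theorem stmt11 (Cm Tm : FGModuleCat A) (n : ℕ)
    (htilt : nTiltingPair A Cm Tm n) (M : FGModuleCat A) :
    (M ∈ omX (addOf Tm) ↔
      (∀ i ≥ 1, extZero (FGModuleCat A) i Tm M) ∧ M ∈ omX (addOf Cm)) ∧
    (M ∈ omX (addOf Tm) ↔ M ∈ Pres (omX (addOf Cm)) (addOf Tm) n) := by
  obtain ⟨⟨hC, hT, -, hCT⟩, hn⟩ := htilt
  have h : IsTiltingPairOfDim Cm Tm n :=
    ⟨extVanishAbove_zero_iff.2 hC, extVanishAbove_zero_iff.2 hT, hn, hCT⟩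
  rw [← extVanishAbove_zero_iff]
  exact ⟨h.mem_omX_iff, h.mem_omX_iff_mem_Pres⟩

end ArtinAlgebra
end
end

section
/- Let C be a self-orthogonal module over an Artin algebra A such that _CX has a relative injective cogenerator I. If D is relative coresolving in _CX, then every module X∈check(_CX) with Ext^1(X,D)=0 for all D∈D satisfies Ext^i(X,D)=0 for all D∈D and all i≥1. -/
open CategoryTheory CategoryTheory.Limits Opposite

set_option synthInstance.maxHeartbeats 800000

noncomputable section

universe v u

variable (C : Type u) [Category.{v} C] [Abelian C] [EnoughProjectives C] [EnoughInjectives C]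

variable {C}

section ExtVanishing

variable {C : Type u} [Category.{v} C] [Abelian C] [EnoughProjectives C]

/-- Vanishing of `Ext`, computed by cocycles on a projective resolution. -/
lemma extZero_succ_iff_forall_cocycle {X : C} (P : ProjectiveResolution X) (n : ℕ) (Y : C) :
    extZero C (n + 1) X Y ↔ ∀ f : P.complex.X (n + 1) ⟶ Y,
      P.complex.d (n + 2) (n + 1) ≫ f = 0 →
        ∃ g : P.complex.X n ⟶ Y, P.complex.d (n + 1) n ≫ g = f := by
  unfold extZero
  rw [(P.isoExt (R := ℤ) (n + 1) Y).isZero_iff,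
    ← HomologicalComplex.exactAt_iff_isZero_homology,
    HomologicalComplex.exactAt_iff' _ n (n + 1) (n + 2) (by simp) (by simp),
    ShortComplex.moduleCat_exact_iff]
  rfl

/-- Vanishing of `Ext` agrees with vanishing of the `Ext` groups of the derived category. -/
lemma extZero_succ_iff_forall_eq_zero [HasExt.{v} C] (n : ℕ) (X Y : C) :
    extZero C (n + 1) X Y ↔ ∀ x : Abelian.Ext.{v} X Y (n + 1), x = 0 := by
  let P := projectiveResolution X
  rw [extZero_succ_iff_forall_cocycle P]
  refine ⟨fun h x => ?_, fun h f hf => ?_⟩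
  · obtain ⟨f, hf, rfl⟩ := P.extMk_surjective x (n + 2) rfl
    exact (P.extMk_eq_zero_iff f _ rfl hf n rfl).2 (h f hf)
  · exact (P.extMk_eq_zero_iff f _ rfl hf n rfl).1 (h _)

lemma extZero_of_iso {n : ℕ} {X X' : C} (e : X ≅ X') {Y : C} (h : extZero C n X' Y) :
    extZero C n X Y :=
  IsZero.of_iso h (((Ext ℤ C n).mapIso e.symm.op).app Y)

/-- Dimension shift in the first variable. -/
lemma extZero_left_of_SES {X W X' Y : C} (h : SES X W X') {n : ℕ}
    (hW : extZero C (n + 1) W Y) (hX' : extZero C (n + 2) X' Y) :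
    extZero C (n + 1) X Y := by
  have : HasExt.{v} C := hasExt_of_enoughProjectives.{v} C
  obtain ⟨f, g, w, hS⟩ := h
  rw [extZero_succ_iff_forall_eq_zero] at *
  intro x
  obtain ⟨y, rfl⟩ := Abelian.Ext.contravariant_sequence_exact₁ hS Y x
    (n₁ := n + 2) (by lia) (hX' _)
  rw [hW y, Abelian.Ext.comp_zero]

/-- Dimension shift in the second variable. -/
lemma extZero_right_of_SES {X Y W Y' : C} (h : SES Y W Y') {n : ℕ}
    (hY' : extZero C (n + 1) X Y') (hW : extZero C (n + 2) X W) :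
    extZero C (n + 2) X Y := by
  have : HasExt.{v} C := hasExt_of_enoughProjectives.{v} C
  obtain ⟨f, g, w, hS⟩ := h
  rw [extZero_succ_iff_forall_eq_zero] at *
  intro x
  obtain ⟨y, rfl⟩ := Abelian.Ext.covariant_sequence_exact₁ X hS x (hW _) (n₀ := n + 1) rfl
  rw [hY' y, Abelian.Ext.zero_comp]

/-- Left orthogonality to an object passes to objects with a finite coresolution. -/
lemma extZero_of_mem_checkCat {ω : Set C} {Y : C}
    (hY : ∀ Z ∈ ω, ∀ i ≥ 1, extZero C i Z Y) {X : C} (hX : X ∈ checkCat ω) :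
    ∀ i ≥ 1, extZero C i X Y := by
  obtain ⟨m, hm⟩ := Set.mem_iUnion.1 hX
  clear hX
  induction m generalizing X with
  | zero =>
    obtain ⟨W, hW, ⟨e⟩⟩ := hm
    exact fun i hi => extZero_of_iso e (hY W hW i hi)
  | succ m ih =>
    obtain ⟨W, hW, X', hS, hX'⟩ := hm
    rintro (_ | i) hi
    · lia
    · exact extZero_left_of_SES hS (hY W hW _ hi) (ih hX' _ (by lia))

end ExtVanishing

section ArtinAlgebra

variable {R : Type} [CommRing R] [IsArtinianRing R]
variable {A : Type} [Ring A] [Algebra R A] [Module.Finite R A]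
variable [Abelian (FGModuleCat A)] [EnoughProjectives (FGModuleCat A)]
variable [EnoughInjectives (FGModuleCat A)]
variable [Limits.HasBinaryBiproducts (FGModuleCat A)]

theorem stmt17 (Cm : FGModuleCat A) (hC : SelfOrthMod A Cm)
    (I : Set (FGModuleCat A)) (hI : RelInjCogen I (omX (addOf Cm)))
    (D : Set (FGModuleCat A)) (hDsub : D ⊆ omX (addOf Cm)) (hID : I ⊆ D)
    (hext : ∀ X Y Z : FGModuleCat A, SES X Y Z → X ∈ D → Z ∈ D → Y ∈ D)
    (hcok : ∀ X Y Z : FGModuleCat A, SES X Y Z → X ∈ D → Y ∈ D → Z ∈ D)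
    (hsum : ∀ X Y : FGModuleCat A, (X ⊞ Y) ∈ D → X ∈ D) :
    ∀ X ∈ checkCat (omX (addOf Cm)),
      (∀ D₀ ∈ D, extZero (FGModuleCat A) 1 X D₀) →
        ∀ D₀ ∈ D, ∀ i ≥ 1, extZero (FGModuleCat A) i X D₀ := by
  intro X hX h1
  have key (n : ℕ) : ∀ D₀ ∈ D, extZero (FGModuleCat A) (n + 1) X D₀ := by
    induction n with
    | zero => exact h1
    | succ n ih =>
      intro D₀ hD₀
      obtain ⟨I₀, hI₀, Z, -, hS⟩ := hI.2.2 D₀ (hDsub hD₀)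
      exact extZero_right_of_SES hS (ih Z (hcok _ _ _ hS hD₀ (hID hI₀)))
        (extZero_of_mem_checkCat (hI.2.1 I₀ hI₀) hX _ (by lia))
  rintro D₀ hD₀ (_ | i) hi
  · lia
  · exact key i D₀ hD₀

end ArtinAlgebra
end
end
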